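/- Let A be a Banach algebra such that the quotient A/ran(A) by the right annihilator is commutative and semisimple (its Jacobson radical is zero). If d₁ and d₂ are derivations of A, then the composition d₁∘d₂ is a derivation of A. -/

import Mathlib

/-- The right annihilator `ran(A) = {x | ∀ a, a * x = 0}` of `A`, as a two-sided ideal. -/
def ranIdeal (A : Type*) [NonUnitalNormedRing A] : TwoSidedIdeal A :=
  TwoSidedIdeal.mk' {x | ∀ a : A, a * x = 0}
    (fun a => mul_zero a)
    (fun hx hy a => by rw [mul_add, hx a, hy a, add_zero])
    (fun hx a => by rw [mul_neg, hx a, neg_zero])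
    (fun {x y} hy a => by rw [← mul_assoc, hy (a * x)])
    (fun {x y} hx a => by rw [← mul_assoc, hx a, zero_mul])

/-- The quotient algebra `A / ran(A)`. -/
abbrev RanQuot (A : Type*) [NonUnitalNormedRing A] := (ranIdeal A).ringCon.Quotient

section helpers

open Filter Topology

/-- A continuous multiplicative functional. -/
def IsMulFun {A : Type*} [NonUnitalNormedRing A] [NormedSpace ℂ A] (φ : A →L[ℂ] ℂ) : Prop :=
  ∀ x y, φ (x * y) = φ x * φ y

lemma mem_ranIdeal {A : Type*} [NonUnitalNormedRing A] (x : A) :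
    x ∈ ranIdeal A ↔ ∀ a : A, a * x = 0 := by
  unfold ranIdeal
  rw [TwoSidedIdeal.mem_mk']
  rfl

lemma mk_eq_iff {A : Type*} [NonUnitalNormedRing A] (x y : A) :
    ((x : RanQuot A) = (y : RanQuot A)) ↔ ∀ a : A, a * (x - y) = 0 := by
  rw [RingCon.eq, TwoSidedIdeal.rel_iff, mem_ranIdeal]

lemma gelfand_aux {C : Type*} [NormedRing C] [NormedAlgebra ℂ C] [CompleteSpace C]
    (h : ∀ x y : C, x * y = y * x) (c : C)
    (hc : ∀ χ : C →L[ℂ] ℂ, (∀ x y, χ (x * y) = χ x * χ y) → χ 1 = 1 → χ c ≠ 0) : IsUnit c := by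
  let : NormedCommRing C := { ‹NormedRing C› with mul_comm := h }
  by_contra hn
  obtain ⟨f, hf⟩ := WeakDual.CharacterSpace.exists_apply_eq_zero (A := C) hn
  exact hc (WeakDual.CharacterSpace.toCLM f) (fun x y => map_mul f x y) (map_one f) hf

variable {A : Type*} [NonUnitalNormedRing A] [NormedSpace ℂ A]
    [IsScalarTower ℂ A A] [SMulCommClass ℂ A A] [CompleteSpace A]

lemma quasi_inv (hcomm : ∀ x y a : A, a * (x * y) = a * (y * x)) (x : A)
    (hx : ∀ φ : A →L[ℂ] ℂ, IsMulFun φ → φ x = 0) : ∃ w : A, w + x + w * x = 0 := by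
  let R : A →L[ℂ] (A →L[ℂ] A) := (ContinuousLinearMap.mul ℂ A).flip
  have hR : ∀ x a, R x a = a * x := fun x a => rfl
  have hRm : ∀ x y, R (x * y) = R x * R y := by
    intro x y
    ext a
    rw [hR, hcomm, ← mul_assoc]
    rfl
  have hRc : ∀ x y, R x * R y = R y * R x := by
    intro x y
    rw [← hRm]
    ext a
    rw [hR, ← mul_assoc]
    rfl
  let C : Subalgebra ℂ (A →L[ℂ] A) :=
    Subalgebra.centralizer ℂ (Set.centralizer (Set.range R))
  have hRC : ∀ x, R x ∈ C := by
    intro x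
    exact Set.subset_centralizer_centralizer ⟨x, rfl⟩
  have hCcomm : ∀ x y : C, x * y = y * x := by
    rintro ⟨x, hx⟩ ⟨y, hy⟩
    apply Subtype.ext
    have : x ∈ Set.centralizer (Set.range R) := by
      intro m hm
      refine hx m ?_
      rintro _ ⟨u, rfl⟩
      obtain ⟨v, rfl⟩ := hm
      exact hRc u v
    exact hy x this
  have hcl : IsClosed (C : Set (A →L[ℂ] A)) := Set.isClosed_centralizer _
  have : CompleteSpace C := hcl.completeSpace_coe
  let c : C := 1 + ⟨R x, hRC x⟩
  have hu : IsUnit c := by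
    refine gelfand_aux hCcomm c ?_
    intro χ hχ h1
    let ψ : A →L[ℂ] ℂ := χ.comp (R.codRestrict (Subalgebra.toSubmodule C) hRC)
    have hψ : IsMulFun ψ := by
      intro u v
      show χ ⟨R (u * v), hRC _⟩ = χ ⟨R u, hRC _⟩ * χ ⟨R v, hRC _⟩
      rw [← hχ]
      congr 1
      exact Subtype.ext (hRm u v)
    have h0 : χ ⟨R x, hRC x⟩ = 0 := hx ψ hψ
    show χ (1 + ⟨R x, hRC x⟩) ≠ 0
    rw [map_add, h1, h0]
    norm_num
  obtain ⟨⟨c, d, hcd, _⟩, hc⟩ := hu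
  have h1 : (c : A →L[ℂ] A) * (d : A →L[ℂ] A) = 1 := congrArg Subtype.val hcd
  have hc' : (c : A →L[ℂ] A) = 1 + R x := congrArg Subtype.val hc
  rw [hc'] at h1
  have h2 := congrArg (fun T : A →L[ℂ] A => T (-x)) h1
  refine ⟨(d : A →L[ℂ] A) (-x), ?_⟩
  have h3 : (d : A →L[ℂ] A) (-x) + (d : A →L[ℂ] A) (-x) * x = -x := h2
  rw [add_right_comm, h3]
  simp

lemma keyK
    (hcomm : ∀ x y : RanQuot A, x * y = y * x)
    (hss : ∀ x : RanQuot A,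
      (↑x : Unitization ℤ (RanQuot A)) ∈ (⊥ : Ideal (Unitization ℤ (RanQuot A))).jacobson →
        x = 0) (x : A)
    (hx : ∀ φ : A →L[ℂ] ℂ, IsMulFun φ → φ x = 0) : ∀ a : A, a * x = 0 := by
  have hcomm' : ∀ x y a : A, a * (x * y) = a * (y * x) := by
    intro x y a
    have := (mk_eq_iff (x * y) (y * x)).1 (hcomm x y) a
    rwa [mul_sub, sub_eq_zero] at this
  have := hss (x : RanQuot A) ?_
  · have h := (mk_eq_iff x 0).1 this
    simpa using h
  rw [Ideal.mem_jacobson_iff]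
  intro y
  obtain ⟨b, hb⟩ := Quotient.exists_rep y.snd
  change ((b : A) : RanQuot A) = y.snd at hb
  obtain ⟨w, hw⟩ := quasi_inv hcomm' (y.fst • x + b * x) (by
    intro φ hφ
    rw [map_add, map_zsmul, hφ, hx φ hφ]; simp)
  refine ⟨1 + ((w : A) : RanQuot A), ?_⟩
  rw [Ideal.mem_bot]
  have hy : y * (((x : A) : RanQuot A) : Unitization ℤ (RanQuot A)) =
      (((y.fst • x + b * x : A) : RanQuot A) : Unitization ℤ (RanQuot A)) := by
    ext
    · simp
    · simp only [Unitization.snd_mul, Unitization.fst_inr, Unitization.snd_inr, zero_smul,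
        add_zero, ← hb]
      rfl
  rw [mul_assoc, hy]
  have h2 : ((w : A) : RanQuot A) + ((y.fst • x + b * x : A) : RanQuot A)
      + ((w : A) : RanQuot A) * ((y.fst • x + b * x : A) : RanQuot A) = 0 :=
    congrArg (fun t : A => (t : RanQuot A)) hw
  have h3 := congrArg (fun t : RanQuot A => (t : Unitization ℤ (RanQuot A))) h2
  simp only [Unitization.inr_add, Unitization.inr_mul, Unitization.inr_zero] at h3
  rw [← h3]
  noncomm_ring

lemma le_mul_of_eps {a b c : ℝ} (hc : 0 ≤ c) (h : ∀ ε > 0, a ≤ c * (b + ε)) : a ≤ c * b := by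
  refine le_of_forall_pos_le_add fun ε hε => ?_
  have h1 := h (ε / (c + 1)) (by positivity)
  have h2 : c * (ε / (c + 1)) ≤ ε := by
    rw [mul_div_assoc', div_le_iff₀ (by positivity)]
    nlinarith
  rw [mul_add] at h1
  linarith

lemma closed_graph_aux (D : A →ₗ[ℂ] A) (Φ : Set (A →L[ℂ] ℂ))
    (hΦ : ∀ φ ∈ Φ, ∃ M : ℝ, ∀ x, ‖φ (D x)‖ ≤ M * ‖x‖) :
    ∃ (N : A → ℝ) (M : ℝ), 0 ≤ M ∧ (∀ x, N x ≤ ‖x‖) ∧ (∀ x, N (D x) ≤ M * ‖x‖) ∧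
      (∀ ψ : A →L[ℂ] ℂ, (∀ x, (∀ φ ∈ Φ, φ x = 0) → ψ x = 0) → ∀ x, ‖ψ x‖ ≤ ‖ψ‖ * N x) ∧
      ((∀ x, (∀ φ ∈ Φ, φ x = 0) → (∀ φ ∈ Φ, φ (D x) = 0)) → ∀ x, N (D x) ≤ M * N x) := by
  let J : Submodule ℂ A := ⨅ φ ∈ Φ, LinearMap.ker (φ : A →ₗ[ℂ] ℂ)
  have hJ : ∀ x, x ∈ J ↔ ∀ φ ∈ Φ, φ x = 0 := by
    intro x
    simp [J, Submodule.mem_iInf]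
  have hcl : IsClosed (J : Set A) := by
    have : (J : Set A) = ⋂ φ ∈ Φ, {x | φ x = 0} := by
      ext x
      simp [hJ]
    rw [this]
    exact isClosed_biInter fun φ _ => isClosed_eq φ.continuous continuous_const
  have : IsClosed (J : Set A) := hcl
  have hψ : ∀ ψ : A →L[ℂ] ℂ, (∀ x ∈ J, ψ x = 0) → ∀ x, ‖ψ x‖ ≤ ‖ψ‖ * ‖J.mkQ x‖ := by
    intro ψ h x
    refine le_mul_of_eps (norm_nonneg _) fun ε hε => ?_
    obtain ⟨y, hy, hy'⟩ := Submodule.Quotient.norm_mk_lt (J.mkQ x) hε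
    have h1 : ψ y = ψ x := by
      have := h (y - x) ((Submodule.Quotient.eq J).1 hy)
      rwa [map_sub, sub_eq_zero] at this
    rw [← h1]
    exact (ψ.le_opNorm y).trans (by gcongr)
  have hc : Continuous (J.mkQ ∘ₗ D) := by
    refine LinearMap.continuous_of_seq_closed_graph _ fun u x y hu hy => ?_
    obtain ⟨y, rfl⟩ := J.mkQ_surjective y
    refine (Submodule.Quotient.eq J).2 ((hJ _).2 fun φ hφ => ?_)
    obtain ⟨M, hM⟩ := hΦ φ hφ
    have h1 : Tendsto (fun n => φ (D (u n))) atTop (𝓝 (φ (D x))) := by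
      rw [tendsto_iff_norm_sub_tendsto_zero] at hu ⊢
      refine squeeze_zero (fun _ => norm_nonneg _) (fun n => ?_) (by simpa using hu.const_mul M)
      rw [← map_sub, ← map_sub]
      exact hM _
    have h2 : Tendsto (fun n => φ (D (u n))) atTop (𝓝 (φ y)) := by
      rw [tendsto_iff_norm_sub_tendsto_zero] at hy ⊢
      refine squeeze_zero (fun _ => norm_nonneg _) (fun n => ?_)
        (by simpa using hy.const_mul ‖φ‖)
      rw [← map_sub]
      exact (hψ φ (fun x hx => (hJ x).1 hx φ hφ) _).trans (by simp)
    rw [map_sub, sub_eq_zero]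
    exact tendsto_nhds_unique h2 h1
  let T : A →L[ℂ] (A ⧸ J) := ⟨J.mkQ ∘ₗ D, hc⟩
  have hT : ∀ x, ‖J.mkQ (D x)‖ ≤ ‖T‖ * ‖x‖ := fun x => T.le_opNorm x
  refine ⟨fun x => ‖J.mkQ x‖, ‖T‖, T.opNorm_nonneg, fun x => Submodule.Quotient.norm_mk_le J x,
    hT, ?_, ?_⟩
  · intro ψ h x
    exact hψ ψ (fun x hx => h x ((hJ x).1 hx)) x
  · intro h x
    refine le_mul_of_eps T.opNorm_nonneg fun ε hε => ?_
    obtain ⟨y, hy, hy'⟩ := Submodule.Quotient.norm_mk_lt (J.mkQ x) hε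
    have h1 : J.mkQ (D y) = J.mkQ (D x) := by
      refine (Submodule.Quotient.eq J).2 ((hJ _).2 ?_)
      rw [← map_sub]
      exact h _ ((hJ _).1 ((Submodule.Quotient.eq J).1 hy))
    show ‖J.mkQ (D x)‖ ≤ ‖T‖ * (‖J.mkQ x‖ + ε)
    rw [← h1]
    exact (hT y).trans (by gcongr)

lemma leibniz_iter (D : A →ₗ[ℂ] A) (hD : ∀ a x : A, D (a * x) = D a * x + a * D x)
    (n : ℕ) (a b : A) :
    D^[n] (a * b) = ∑ ij ∈ Finset.HasAntidiagonal.antidiagonal n, n.choose ij.1 • (D^[ij.1] a * D^[ij.2] b) := by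
  induction n with
  | zero => simp
  | succ n ih =>
    rw [Finset.sum_antidiagonal_choose_succ_nsmul (M := A) (fun i j => D^[i] a * D^[j] b) n]
    simp only [Function.iterate_succ_apply', ih, map_sum, map_nsmul, hD, smul_add,
      Finset.sum_add_distrib]
    rw [add_comm]
    congr 1
    refine Finset.sum_congr rfl fun ⟨i, j⟩ hij ↦ ?_
    rw [n.choose_symm_of_eq_add (Finset.HasAntidiagonal.mem_antidiagonal.1 hij).symm]

/-- `pw a n = a ^ (n + 1)`. -/
def pw (a : A) : ℕ → A
  | 0 => a
  | n + 1 => a * pw a n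

lemma pw_norm (a : A) (n : ℕ) : ‖pw a n‖ ≤ ‖a‖ ^ (n + 1) := by
  induction n with
  | zero => simp [pw]
  | succ n ih =>
    rw [pw, pow_succ']
    exact (norm_mul_le _ _).trans (by gcongr)

lemma phi_iter (D : A →ₗ[ℂ] A) (hD : ∀ a x : A, D (a * x) = D a * x + a * D x)
    (φ : A →L[ℂ] ℂ) (hφ : IsMulFun φ) (a : A) (ha : φ a = 0) (n : ℕ) :
    (∀ k < n + 1, φ (D^[k] (pw a n)) = 0) ∧
      φ (D^[n + 1] (pw a n)) = (n + 1).factorial * φ (D a) ^ (n + 1) := by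
  induction n with
  | zero => simp [pw, ha]
  | succ n ih =>
    have key : ∀ k, φ (D^[k] (pw a (n + 1))) = ∑ ij ∈ Finset.HasAntidiagonal.antidiagonal k,
        (k.choose ij.1 : ℂ) * (φ (D^[ij.1] a) * φ (D^[ij.2] (pw a n))) := by
      intro k
      rw [pw, leibniz_iter D hD, map_sum]
      refine Finset.sum_congr rfl fun ij _ => ?_
      rw [map_nsmul, hφ, nsmul_eq_mul]
    constructor
    · intro k hk
      rw [key]
      refine Finset.sum_eq_zero ?_
      rintro ⟨i, j⟩ hij
      rw [Finset.HasAntidiagonal.mem_antidiagonal] at hij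
      simp only at hij ⊢
      rcases Nat.eq_zero_or_pos i with rfl | hi
      · simp [ha]
      · rw [ih.1 j (by omega)]; simp
    · rw [key, Finset.sum_eq_single (1, n + 1)]
      · rw [ih.2]
        simp only [Nat.choose_one_right, Function.iterate_one]
        rw [Nat.factorial_succ (n + 1)]
        push_cast
        ring
      · rintro ⟨i, j⟩ hij hne
        rw [Finset.HasAntidiagonal.mem_antidiagonal] at hij
        simp only at hij ⊢
        rcases Nat.eq_zero_or_pos i with rfl | hi
        · simp [ha]
        · rw [ih.1 j ?_]
          · simp
          · by_contra hj
            apply hne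
            ext <;> simp only <;> omega
      · intro h
        exact absurd (Finset.HasAntidiagonal.mem_antidiagonal.2 (by simp only; omega)) h

lemma singer_wermer (D : A →ₗ[ℂ] A) (hD : ∀ a x : A, D (a * x) = D a * x + a * D x)
    (hran : ∀ x : A, (∀ φ : A →L[ℂ] ℂ, IsMulFun φ → φ x = 0) →
      ∀ φ : A →L[ℂ] ℂ, IsMulFun φ → φ (D x) = 0)
    (hcont : ∀ φ : A →L[ℂ] ℂ, IsMulFun φ → ∃ M : ℝ, ∀ x, ‖φ (D x)‖ ≤ M * ‖x‖)
    (φ : A →L[ℂ] ℂ) (hφ : IsMulFun φ) (a : A) : φ (D a) = 0 := by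
  obtain ⟨N, M, hM, hN, -, hψ, hND⟩ := closed_graph_aux D {φ | IsMulFun φ} hcont
  have hND := hND hran
  have hψ := hψ φ (fun x hx => hx φ hφ)
  have hit : ∀ n x, N (D^[n] x) ≤ M ^ n * ‖x‖ := by
    intro n x
    induction n with
    | zero => simpa using hN x
    | succ n ih =>
      rw [Function.iterate_succ_apply', pow_succ', mul_assoc]
      exact (hND _).trans (by gcongr)
  have key : ∀ a, φ a = 0 → φ (D a) = 0 := by
    intro a ha
    by_contra hne
    have hpos : 0 < ‖φ (D a)‖ := norm_pos_iff.2 hne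
    set t := ‖φ (D a)‖ with ht
    have hb : ∀ n : ℕ, (n + 1).factorial * t ^ (n + 1) ≤ ‖φ‖ * (M * ‖a‖) ^ (n + 1) := by
      intro n
      have h1 := (phi_iter D hD φ hφ a ha n).2
      have h2 : ‖φ (D^[n + 1] (pw a n))‖ = (n + 1).factorial * t ^ (n + 1) := by
        rw [h1, norm_mul, norm_pow, Complex.norm_natCast]
      rw [← h2, mul_pow]
      refine (hψ _).trans ?_
      gcongr
      refine (hit _ _).trans ?_
      gcongr
      exact pw_norm a n
    have hlim := ((FloorSemiring.tendsto_pow_div_factorial_atTop (M * ‖a‖ / t)).const_mul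
      ‖φ‖).comp (tendsto_add_atTop_nat 1)
    rw [mul_zero] at hlim
    have := ge_of_tendsto hlim (b := 1) (Eventually.of_forall fun n => ?_)
    · linarith
    · have := hb n
      simp only [Function.comp]
      rw [div_pow, div_div, mul_div_assoc', le_div_iff₀ (by positivity), one_mul, mul_comm]
      exact this
  by_cases h0 : φ a = 0
  · exact key a h0
  · have h := key (a * a - φ a • a) (by rw [map_sub, hφ, map_smul, smul_eq_mul, sub_self])
    rw [map_sub, map_sub, hD, map_add, hφ, hφ, map_smul, map_smul, smul_eq_mul] at h
    have : φ a * φ (D a) = 0 := by linear_combination h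
    exact (mul_eq_zero.1 this).resolve_left h0

lemma sep (φ ψ : A →L[ℂ] ℂ) (hφ : IsMulFun φ) (hψ : IsMulFun ψ) (hφ0 : φ ≠ 0) (hψ0 : ψ ≠ 0)
    (hne : φ ≠ ψ) : ∃ x, φ x = 0 ∧ ψ x ≠ 0 := by
  by_contra! hcon
  obtain ⟨u, hu⟩ : ∃ u, φ u ≠ 0 := by
    by_contra! h
    exact hφ0 (ContinuousLinearMap.ext h)
  have h1 : ∀ x, φ u * ψ x = φ x * ψ u := by
    intro x
    have := hcon (φ u • x - φ x • u) (by simp [mul_comm])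
    simpa [sub_eq_zero] using this
  have h2 := h1 (u * u)
  rw [hφ, hψ] at h2
  have h3 : φ u * (ψ u * (ψ u - φ u)) = 0 := by linear_combination h2
  rcases mul_eq_zero.1 h3 with h | h
  · exact hu h
  rcases mul_eq_zero.1 h with h | h
  · apply hψ0
    ext x
    have := h1 x
    rw [h, mul_zero] at this
    exact (mul_eq_zero.1 this).resolve_left hu
  · apply hne
    ext x
    have := h1 x
    rw [sub_eq_zero.1 h, mul_comm] at this
    exact (mul_right_cancel₀ hu this).symm

lemma choose_c (φ : ℕ → A →L[ℂ] ℂ) (hφ : ∀ n, IsMulFun (φ n)) (h0 : ∀ n, φ n ≠ 0)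
    (hinj : Function.Injective φ) (n : ℕ) :
    ∃ c, ‖c‖ ≤ 1 ∧ φ n c = 0 ∧ ∀ k, n < k → φ k c ≠ 0 := by
  suffices h : ∃ c, φ n c = 0 ∧ ∀ k, n < k → φ k c ≠ 0 by
    obtain ⟨c, hc, hk⟩ := h
    have hpos : (0 : ℝ) < ‖c‖ + 1 := by positivity
    refine ⟨((‖c‖ + 1 : ℝ) : ℂ)⁻¹ • c, ?_, ?_, ?_⟩
    · rw [norm_smul, norm_inv, Complex.norm_real, Real.norm_of_nonneg hpos.le,
        inv_mul_le_iff₀ hpos]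
      linarith
    · simp [hc]
    · intro k hnk
      rw [map_smul, smul_eq_mul]
      refine mul_ne_zero (inv_ne_zero ?_) (hk k hnk)
      exact_mod_cast hpos.ne'
  by_contra! hcon
  let K : Submodule ℂ A := LinearMap.ker (φ n : A →ₗ[ℂ] ℂ)
  have hKc : IsClosed (K : Set A) := isClosed_eq (φ n).continuous continuous_const
  have : CompleteSpace K := hKc.completeSpace_coe
  let P : {k // n < k} → Submodule ℂ K := fun k =>
    LinearMap.ker ((φ k : A →ₗ[ℂ] ℂ) ∘ₗ K.subtype)
  have hPc : ∀ k, IsClosed (P k : Set K) := fun k =>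
    isClosed_eq ((φ k).continuous.comp continuous_subtype_val) continuous_const
  have hU : ⋃ k, (P k : Set K) = Set.univ := by
    rw [Set.eq_univ_iff_forall]
    rintro ⟨x, hx⟩
    obtain ⟨k, hk, hk'⟩ := hcon x hx
    exact Set.mem_iUnion.2 ⟨⟨k, hk⟩, hk'⟩
  obtain ⟨⟨k, hk⟩, hi⟩ := nonempty_interior_of_iUnion_of_closed hPc hU
  have htop := Submodule.eq_top_of_nonempty_interior' _ hi
  obtain ⟨x, hx, hx'⟩ := sep (φ n) (φ k) (hφ n) (hφ k) (h0 n) (h0 k)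
    (fun h => hk.ne (hinj h))
  have : (⟨x, hx⟩ : K) ∈ P ⟨k, hk⟩ := by rw [htop]; trivial
  exact hx' this

/-- `Cop c n z = c 0 * (c 1 * ... (c (n-1) * z))`. -/
def Cop (c : ℕ → A) : ℕ → A → A
  | 0, z => z
  | n + 1, z => Cop c n (c n * z)

/-- Terms of the tail series. -/
def Tt (c a : ℕ → A) : ℕ → ℕ → A
  | n, 0 => a n
  | n, k + 1 => c n * Tt c a (n + 1) k

lemma Cop_add (c : ℕ → A) (n : ℕ) (x y : A) : Cop c n (x + y) = Cop c n x + Cop c n y := by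
  induction n generalizing x y with
  | zero => rfl
  | succ n ih => simp only [Cop, mul_add, ih]

lemma Cop_mul (c : ℕ → A) (n : ℕ) (x y : A) : Cop c n (x * y) = Cop c n x * y := by
  induction n generalizing x y with
  | zero => rfl
  | succ n ih => simp only [Cop, ← mul_assoc, ih]

lemma tail_exists (c a : ℕ → A) (hc : ∀ n, ‖c n‖ ≤ 1) (ha : ∀ n, ‖a n‖ ≤ (1 / 2) ^ n) :
    ∃ y : ℕ → A, (∀ n, ‖y n‖ ≤ 2) ∧ ∀ n, y n = a n + c n * y (n + 1) := by
  have hT : ∀ k n, ‖Tt c a n k‖ ≤ (1 / 2) ^ k := by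
    have hT' : ∀ k n, ‖Tt c a n k‖ ≤ (1 / 2) ^ (n + k) := by
      intro k
      induction k with
      | zero => intro n; simpa [Tt] using ha n
      | succ k ih =>
        intro n
        rw [Tt]
        calc _ ≤ ‖c n‖ * ‖Tt c a (n + 1) k‖ := norm_mul_le _ _
          _ ≤ 1 * (1 / 2) ^ (n + 1 + k) := by
              gcongr
              · exact hc n
              · exact ih _
          _ = _ := by rw [one_mul]; congr 1; omega
    intro k n
    refine (hT' k n).trans ?_
    exact pow_le_pow_of_le_one (by norm_num) (by norm_num) (by omega)
  have hs : ∀ n, Summable (Tt c a n) := fun n =>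
    Summable.of_norm_bounded summable_geometric_two (fun k => hT k n)
  refine ⟨fun n => ∑' k, Tt c a n k, fun n => ?_, fun n => ?_⟩
  · exact tsum_of_norm_bounded hasSum_geometric_two (fun k => hT k n)
  · simp only
    rw [(hs n).tsum_eq_zero_add, ← (hs (n + 1)).tsum_mul_left]
    rfl

lemma big_of_unbounded (f : A →ₗ[ℂ] ℂ) (hf : ¬ ∃ M : ℝ, ∀ x, ‖f x‖ ≤ M * ‖x‖) (ε K : ℝ)
    (hε : 0 < ε) : ∃ a, ‖a‖ ≤ ε ∧ K ≤ ‖f a‖ := by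
  by_contra! h
  refine hf (LinearMap.bound_of_ball_bound hε K f fun z hz => (h z ?_).le)
  simpa using (mem_ball_zero_iff.1 hz).le

lemma no_inj_seq (D : A →ₗ[ℂ] A) (hD : ∀ a x : A, D (a * x) = D a * x + a * D x)
    (φ : ℕ → A →L[ℂ] ℂ) (hφ : ∀ n, IsMulFun (φ n)) (hinj : Function.Injective φ)
    (hun : ∀ n, ¬ ∃ M : ℝ, ∀ x, ‖φ n (D x)‖ ≤ M * ‖x‖) : False := by
  have h0 : ∀ n, φ n ≠ 0 := by
    intro n h
    exact hun n ⟨0, fun x => by simp [h]⟩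
  choose c hc1 hc0 hck using choose_c φ hφ h0 hinj
  -- behaviour of `φ m ∘ D ∘ Cop c n`
  have hform : ∀ n m, n ≤ m → ∃ γ π : ℂ, π ≠ 0 ∧
      ∀ z, φ m (D (Cop c n z)) = γ * φ m z + π * φ m (D z) := by
    intro n
    induction n with
    | zero => intro m _; exact ⟨0, 1, one_ne_zero, fun z => by simp [Cop]⟩
    | succ n ih =>
      intro m hm
      obtain ⟨γ, π, hπ, h⟩ := ih m (by omega)
      refine ⟨γ * φ m (c n) + π * φ m (D (c n)), π * φ m (c n),
        mul_ne_zero hπ (hck n m (by omega)), fun z => ?_⟩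
      rw [Cop, h, hD, map_add, hφ, hφ, hφ]
      ring
  have hpick : ∀ (n : ℕ) (s : A), ∃ a, ‖a‖ ≤ (1 / 2) ^ n ∧
      n * ‖φ n‖ + 1 + ‖φ n (D s)‖ + ‖φ n (D (Cop c n (c n)))‖ * (‖φ n‖ * 2)
        ≤ ‖φ n (D (Cop c n a))‖ := by
    intro n s
    obtain ⟨γ, π, hπ, h⟩ := hform n n le_rfl
    let f : A →ₗ[ℂ] ℂ := γ • (φ n : A →ₗ[ℂ] ℂ) + π • ((φ n : A →ₗ[ℂ] ℂ) ∘ₗ D)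
    have hf : ∀ z, f z = φ n (D (Cop c n z)) := fun z => by rw [h]; rfl
    have hunb : ¬ ∃ M : ℝ, ∀ x, ‖f x‖ ≤ M * ‖x‖ := by
      rintro ⟨M, hM⟩
      refine hun n ⟨‖π‖⁻¹ * (M + ‖γ‖ * ‖φ n‖), fun x => ?_⟩
      have h1 : π * φ n (D x) = f x - γ * φ n x := by rw [hf, h]; ring
      have h2 : ‖π‖ * ‖φ n (D x)‖ ≤ M * ‖x‖ + ‖γ‖ * (‖φ n‖ * ‖x‖) := by
        rw [← norm_mul, h1]
        refine (norm_sub_le _ _).trans ?_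
        rw [norm_mul]
        gcongr
        · exact hM x
        · exact (φ n).le_opNorm x
      have hp : 0 < ‖π‖ := norm_pos_iff.2 hπ
      rw [mul_assoc, le_inv_mul_iff₀ hp]
      linarith
    obtain ⟨a, ha, hK⟩ := big_of_unbounded f hunb ((1 / 2) ^ n)
      (n * ‖φ n‖ + 1 + ‖φ n (D s)‖ + ‖φ n (D (Cop c n (c n)))‖ * (‖φ n‖ * 2)) (by positivity)
    exact ⟨a, ha, by rwa [hf] at hK⟩
  choose pick hp1 hp2 using hpick
  let s : ℕ → A := fun n => Nat.rec 0 (fun n s => s + Cop c n (pick n s)) n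
  have hs0 : s 0 = 0 := rfl
  have hs : ∀ n, s (n + 1) = s n + Cop c n (pick n (s n)) := fun n => rfl
  obtain ⟨y, hy2, hy⟩ := tail_exists c (fun n => pick n (s n)) hc1 (fun n => hp1 n _)
  have hsum : ∀ n, y 0 = s n + Cop c n (y n) := by
    intro n
    induction n with
    | zero => rw [hs0, zero_add]; rfl
    | succ n ih =>
      rw [ih, hs, hy n, Cop_add, add_assoc]
      rfl
  obtain ⟨n, hn⟩ := exists_nat_ge ‖D (y 0)‖
  have h1 := hp2 n (s n)
  have h2 : φ n (D (Cop c n (pick n (s n)))) = φ n (D (y 0)) - φ n (D (s n))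
      - φ n (D (Cop c n (c n))) * φ n (y (n + 1)) := by
    have hzero : φ n (Cop c n (c n)) = 0 := by
      have : ∀ m z, φ n z = 0 → φ n (Cop c m z) = 0 := by
        intro m
        induction m with
        | zero => intro z hz; exact hz
        | succ m ih => intro z hz; exact ih _ (by rw [hφ, hz, mul_zero])
      exact this n _ (hc0 n)
    rw [hsum n, hy n, Cop_add, Cop_mul]
    simp only [map_add, hD, hφ n _ _, hzero]
    ring
  have h3 : ‖φ n (D (Cop c n (pick n (s n))))‖ ≤ ‖φ n‖ * n + ‖φ n (D (s n))‖
      + ‖φ n (D (Cop c n (c n)))‖ * (‖φ n‖ * 2) := by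
    rw [h2]
    refine (norm_sub_le _ _).trans ?_
    rw [norm_mul]
    gcongr
    · refine (norm_sub_le _ _).trans ?_
      gcongr
      exact ((φ n).le_opNorm _).trans (by gcongr)
    · exact ((φ n).le_opNorm _).trans (by gcongr; exact hy2 _)
  linarith

lemma all_bounded (D : A →ₗ[ℂ] A) (hD : ∀ a x : A, D (a * x) = D a * x + a * D x)
    (hran : ∀ x : A, (∀ φ : A →L[ℂ] ℂ, IsMulFun φ → φ x = 0) →
      ∀ φ : A →L[ℂ] ℂ, IsMulFun φ → φ (D x) = 0)
    (φ : A →L[ℂ] ℂ) (hφ : IsMulFun φ) : ∃ M : ℝ, ∀ x, ‖φ (D x)‖ ≤ M * ‖x‖ := by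
  by_contra hun
  let F : Set (A →L[ℂ] ℂ) := {ψ | IsMulFun ψ ∧ ¬ ∃ M : ℝ, ∀ x, ‖ψ (D x)‖ ≤ M * ‖x‖}
  have hF0 : ∀ ψ ∈ F, ψ ≠ 0 := by
    rintro ψ ⟨-, h⟩ rfl
    exact h ⟨0, fun x => by simp⟩
  have hFin : F.Finite := by
    by_contra hinf
    have hinf : F.Infinite := hinf
    let e := hinf.natEmbedding
    exact no_inj_seq D hD (fun n => (e n : A →L[ℂ] ℂ)) (fun n => (e n).2.1)
      (fun m n h => e.injective (Subtype.ext h)) (fun n => (e n).2.2)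
  have hφF : φ ∈ F := ⟨hφ, hun⟩
  let G : Set (A →L[ℂ] ℂ) := {ψ | IsMulFun ψ ∧ ∃ M : ℝ, ∀ x, ‖ψ (D x)‖ ≤ M * ‖x‖}
  have hJ : ∃ u, (∀ ψ ∈ G, ψ u = 0) ∧ φ u ≠ 0 := by
    by_contra! hcon
    obtain ⟨N, M, hM, -, hN, hψ, -⟩ := closed_graph_aux D G (fun ψ h => h.2)
    refine hun ⟨‖φ‖ * M, fun x => ?_⟩
    rw [mul_assoc]
    exact (hψ φ hcon _).trans (by gcongr; exact hN x)
  obtain ⟨u, huG, hu⟩ := hJ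
  have hsepF : ∃ v, (∀ ψ ∈ G, ψ v = 0) ∧ φ v ≠ 0 ∧ ∀ ψ ∈ F, ψ ≠ φ → ψ v = 0 := by
    have : ∀ S : Set (A →L[ℂ] ℂ), S.Finite → S ⊆ F →
        ∃ v, (∀ ψ ∈ G, ψ v = 0) ∧ φ v ≠ 0 ∧ ∀ ψ ∈ S, ψ ≠ φ → ψ v = 0 := by
      intro S hS
      induction S, hS using Set.Finite.induction_on with
      | empty => intro _; exact ⟨u, huG, hu, by simp⟩
      | @insert ψ S _ _ ih =>
        intro hSF
        obtain ⟨v, hvG, hv, hvS⟩ := ih (fun x hx => hSF (Set.mem_insert_of_mem _ hx))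
        have hψF : ψ ∈ F := hSF (Set.mem_insert _ _)
        by_cases hEq : ψ = φ
        · refine ⟨v, hvG, hv, ?_⟩
          rintro χ (rfl | hχ) hne
          · exact absurd hEq hne
          · exact hvS χ hχ hne
        · obtain ⟨w, hw, hw'⟩ := sep ψ φ hψF.1 hφ (hF0 _ hψF) (hF0 _ hφF) hEq
          refine ⟨v * w, ?_, ?_, ?_⟩
          · intro χ hχ
            rw [hχ.1, hvG χ hχ, zero_mul]
          · rw [hφ]; exact mul_ne_zero hv hw'
          · rintro χ (rfl | hχ) hne
            · rw [hψF.1, hw, mul_zero]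
            · rw [(hSF (Set.mem_insert_of_mem _ hχ)).1, hvS χ hχ hne, zero_mul]
    exact this F hFin subset_rfl
  obtain ⟨v, hvG, hv, hvF⟩ := hsepF
  have hoff : ∀ ψ, IsMulFun ψ → ψ ≠ φ → ψ v = 0 := by
    intro ψ hψ hne
    by_cases hb : ∃ M : ℝ, ∀ x, ‖ψ (D x)‖ ≤ M * ‖x‖
    · exact hvG ψ ⟨hψ, hb⟩
    · exact hvF ψ ⟨hψ, hb⟩ hne
  refine hun ⟨0, fun x => ?_⟩
  have h := hran (v * x - φ x • v) (by
    intro ψ hψ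
    rw [map_sub, hψ, map_smul, smul_eq_mul]
    by_cases hEq : ψ = φ
    · rw [hEq]; ring
    · rw [hoff ψ hψ hEq]; ring) φ hφ
  rw [map_sub, map_sub, hD, map_add, hφ, hφ, map_smul, map_smul, smul_eq_mul] at h
  have h2 : φ v * φ (D x) = 0 := by linear_combination h
  rw [(mul_eq_zero.1 h2).resolve_left hv]
  simp

lemma der_ran
    (hcomm : ∀ x y : RanQuot A, x * y = y * x)
    (hss : ∀ x : RanQuot A,
      (↑x : Unitization ℤ (RanQuot A)) ∈ (⊥ : Ideal (Unitization ℤ (RanQuot A))).jacobson →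
        x = 0)
    (D : A →ₗ[ℂ] A) (hD : ∀ a x : A, D (a * x) = D a * x + a * D x) (x a : A) :
    a * D x = 0 := by
  have hran : ∀ x : A, (∀ φ : A →L[ℂ] ℂ, IsMulFun φ → φ x = 0) →
      ∀ φ : A →L[ℂ] ℂ, IsMulFun φ → φ (D x) = 0 := by
    intro x hx φ hφ
    have h1 := keyK hcomm hss x hx
    have h2 : D x * D x = 0 := by
      have := hD (D x) x
      rw [h1, h1, map_zero, zero_add] at this
      exact this.symm
    have h3 := hφ (D x) (D x)
    rw [h2, map_zero] at h3
    exact mul_self_eq_zero.1 h3.symm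
  exact keyK hcomm hss (D x)
    (fun φ hφ => singer_wermer D hD hran (all_bounded D hD hran) φ hφ x) a

end helpers

/-- Let `A` be a complex Banach algebra such that the quotient `A / ran(A)`
by the right annihilator is commutative and semisimple (its Jacobson radical is zero; for the
possibly non-unital ring `A / ran(A)` this means that the only element whose image in the
unitization lies in the Jacobson radical of the unitization is `0`).  If `d₁` and `d₂` are
derivations of `A`, then `d₁ ∘ d₂` is a derivation of `A`. -/
theorem comp_of_derivations_is_derivation
    {A : Type*} [NonUnitalNormedRing A] [NormedSpace ℂ A]
    [IsScalarTower ℂ A A] [SMulCommClass ℂ A A] [CompleteSpace A]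
    (hcomm : ∀ x y : RanQuot A, x * y = y * x)
    (hss : ∀ x : RanQuot A,
      (↑x : Unitization ℤ (RanQuot A)) ∈ (⊥ : Ideal (Unitization ℤ (RanQuot A))).jacobson →
        x = 0)
    (d₁ d₂ : A →ₗ[ℂ] A)
    (hd₁ : ∀ a x : A, d₁ (a * x) = d₁ a * x + a * d₁ x)
    (hd₂ : ∀ a x : A, d₂ (a * x) = d₂ a * x + a * d₂ x) :
    ∀ a x : A, d₁ (d₂ (a * x)) = d₁ (d₂ a) * x + a * d₁ (d₂ x) := by
  intro a x
  have h1 := der_ran hcomm hss d₁ hd₁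
  have h2 := der_ran hcomm hss d₂ hd₂
  rw [h1, hd₂, h2, add_zero, hd₁, h1, add_zero]
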